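/- There is an absolute constant C > 0 with the following property. Let ψ: ℕ → ℝ be non-negative and let m ≠ n be positive integers with 0 < ψ(m) ≤ 1/2 and 0 < ψ(n) ≤ 1/2. With r, s, t defined from the prime factorizations of m and n (r = ∏_{u_p=v_p} p^{u_p}, s = ∏_{u_p≠v_p} p^{min(u_p,v_p)}, t = ∏_{u_p≠v_p} p^{max(u_p,v_p)}), δ = min(ψ(m)/m, ψ(n)/n), Δ = max(ψ(m)/m, ψ(n)/n), and S_t(θ) = (1/θ)·#{1 ≤ b ≤ θ : gcd(b,t) = 1}, one has λ(E_m(ψ) ∩ E_n(ψ)) ≤ C · δ · φ(s) · (φ(r)²/r) · ∫_1^{max(1, 4Δrt)} S_t(θ) dθ. -/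

import Mathlib

open MeasureTheory Filter Finset

/-- The set `E_n(ψ) ⊆ ℝ/ℤ`, the union over `1 ≤ a ≤ n`, `gcd(a,n)=1`, of the
intervals `((a-ψ(n))/n, (a+ψ(n))/n)` taken mod 1. -/
noncomputable def E (ψ : ℕ → ℝ) (n : ℕ) : Set UnitAddCircle :=
  ⋃ a ∈ (Finset.Icc 1 n).filter (fun a => Nat.Coprime a n),
    (fun y : ℝ => (y : UnitAddCircle)) '' Set.Ioo (((a : ℝ) - ψ n) / n) (((a : ℝ) + ψ n) / n)

/-- `W(ψ)`: points of the circle lying in infinitely many sets `E_n(ψ)`. -/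
noncomputable def W (ψ : ℕ → ℝ) : Set UnitAddCircle := {x | ∃ᶠ n in atTop, x ∈ E ψ n}

/-- `log x` understood as `max (1, log x)`. -/
noncomputable def flog (x : ℝ) : ℝ := max 1 (Real.log x)

/-- `S_t(θ) = (1/θ) · #{1 ≤ b ≤ θ : (b,t)=1}`. -/
noncomputable def S (t : ℕ) (θ : ℝ) : ℝ :=
  (((Finset.Icc 1 ⌊θ⌋₊).filter (fun b => Nat.Coprime b t)).card : ℝ) / θ

lemma core_inj (r s M N : ℕ) (hMN : Nat.Coprime M N) (hrN : Nat.Coprime r (M * N))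
    (hrs : Nat.Coprime r s) (hp : ∀ p : ℕ, p.Prime → p ∣ s → p ∣ M * N) (hM : 0 < M) (hN : 0 < N)
    (a a' b b' : ℤ) (ha : IsCoprime a (s : ℤ)) (hb : IsCoprime b' (s : ℤ))
    (h1 : ((M * N * s * r : ℕ) : ℤ) ∣ (a * M - b * N) - (a' * M - b' * N))
    (h2 : (s : ℤ) ∣ a * b - a' * b') (h3 : (r : ℤ) ∣ a - a') :
    ((r * N * s : ℕ) : ℤ) ∣ a - a' ∧ ((r * M * s : ℕ) : ℤ) ∣ b - b' := by
  have cMN : IsCoprime (M : ℤ) (N : ℤ) := Nat.isCoprime_iff_coprime.mpr hMN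
  have crs : IsCoprime (r : ℤ) (s : ℤ) := Nat.isCoprime_iff_coprime.mpr hrs
  have crN : IsCoprime (r : ℤ) (N : ℤ) :=
    Nat.isCoprime_iff_coprime.mpr (Nat.Coprime.coprime_mul_left_right hrN)
  have hM0 : (M : ℤ) ≠ 0 := by exact_mod_cast hM.ne'
  have hN0 : (N : ℤ) ≠ 0 := by exact_mod_cast hN.ne'
  obtain ⟨w, hw⟩ := h1
  push_cast at hw
  have hNa : (N : ℤ) ∣ a - a' := by
    refine cMN.symm.dvd_of_dvd_mul_right ?_
    exact ⟨(b - b') + M * s * r * w, by linear_combination hw⟩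
  have hMb : (M : ℤ) ∣ b - b' := by
    refine cMN.dvd_of_dvd_mul_right ?_
    exact ⟨(a - a') - N * s * r * w, by linear_combination -hw⟩
  obtain ⟨j, hj⟩ := hNa
  obtain ⟨i, hi⟩ := hMb
  have hji : j - i = s * r * w := by
    apply mul_left_cancel₀ (mul_ne_zero hM0 hN0)
    linear_combination hw - M * hj + N * hi
  have hcop : IsCoprime (s : ℤ) (a * M + b' * N) := by
    rw [Int.isCoprime_iff_gcd_eq_one]
    by_contra hne
    obtain ⟨p, pp, hpd⟩ := Nat.exists_prime_and_dvd hne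
    have hps : (p : ℤ) ∣ s := (Int.natCast_dvd_natCast.mpr hpd).trans (Int.gcd_dvd_left ..)
    have hpx : (p : ℤ) ∣ a * M + b' * N := (Int.natCast_dvd_natCast.mpr hpd).trans (Int.gcd_dvd_right ..)
    have pz : Prime (p : ℤ) := Nat.prime_iff_prime_int.mp pp
    have key : ∀ x : ℤ, IsCoprime x (s : ℤ) → ¬ (p : ℤ) ∣ x := fun x hx hd =>
      pz.not_isUnit (hx.isUnit_of_dvd' hd hps)
    have hnot : ¬ ((p : ℤ) ∣ M ∧ (p : ℤ) ∣ N) := fun h => pz.not_isUnit (cMN.isUnit_of_dvd' h.1 h.2)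
    rcases pp.dvd_mul.mp (hp p pp (by exact_mod_cast hps)) with h | h
    · have h' : (p : ℤ) ∣ M := by exact_mod_cast h
      have : (p : ℤ) ∣ b' * N := (dvd_add_right (h'.mul_left a)).mp hpx
      rcases pz.dvd_or_dvd this with h4 | h4
      · exact key _ hb h4
      · exact hnot ⟨h', h4⟩
    · have h' : (p : ℤ) ∣ N := by exact_mod_cast h
      have : (p : ℤ) ∣ a * M := (dvd_add_left (h'.mul_left b')).mp hpx
      rcases pz.dvd_or_dvd this with h4 | h4
      · exact key _ ha h4
      · exact hnot ⟨h4, h'⟩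
  have hsj : (s : ℤ) ∣ j := by
    refine hcop.dvd_of_dvd_mul_right ?_
    obtain ⟨z, hz⟩ := h2
    refine ⟨z + a * M * r * w, ?_⟩
    linear_combination hz - a * hi - b' * hj + a * M * hji
  have hrj : (r : ℤ) ∣ j := by
    refine crN.dvd_of_dvd_mul_left ?_
    rwa [← hj]
  obtain ⟨q, hq⟩ := crs.mul_dvd hrj hsj
  constructor
  · exact ⟨q, by push_cast; rw [hj, hq]; ring⟩
  · exact ⟨q - w, by push_cast; rw [hi]; linear_combination (-M : ℤ) * hji + (M:ℤ) * hq⟩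

noncomputable def FF (r M : ℕ) (k : ℤ) : ℕ :=
  ((range r).filter (fun x : ℕ => x.Coprime r ∧ IsCoprime ((x : ℤ) * M - k) (r : ℤ))).card

lemma isCoprime_emod_shift (x M r q : ℕ) (k : ℤ) (hq : q ∣ r)
    (h : IsCoprime ((x : ℤ) * M - k) (r : ℤ)) :
    IsCoprime (((x % q : ℕ) : ℤ) * M - k) (q : ℤ) := by
  have h1 : IsCoprime ((x : ℤ) * M - k) (q : ℤ) :=
    h.of_isCoprime_of_dvd_right (by exact_mod_cast hq)
  have h2 : (x : ℤ) = ((x % q : ℕ) : ℤ) + q * ((x / q : ℕ) : ℤ) := by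
    exact_mod_cast (Nat.mod_add_div x q).symm
  have h3 : ((x % q : ℕ) : ℤ) * M - k = ((x : ℤ) * M - k) + (q : ℤ) * (-(((x / q : ℕ) : ℤ) * M)) := by
    rw [h2]; simp; ring
  rw [h3]
  exact h1.add_mul_left_left _

lemma coprime_mod_of_dvd (x r q : ℕ) (hq : q ∣ r) (h : x.Coprime r) : (x % q).Coprime q := by
  have := h.coprime_dvd_right hq
  rw [Nat.Coprime, ← Nat.gcd_rec, Nat.gcd_comm] 
  exact this

lemma FF_mul (a b M : ℕ) (k : ℤ) (hab : a.Coprime b) (ha : 0 < a) (hb : 0 < b) :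
    FF (a * b) M k ≤ FF a M k * FF b M k := by
  unfold FF
  rw [← card_product]
  refine card_le_card_of_injOn (fun x => (x % a, x % b)) ?_ ?_
  · intro x hx
    simp only [coe_filter, Set.mem_ofPred_eq, Finset.mem_range] at hx
    obtain ⟨hx, h1, h2⟩ := hx
    simp only [coe_product, Set.mem_prod, coe_filter, Set.mem_ofPred_eq, Finset.mem_range]
    exact ⟨⟨Nat.mod_lt _ ha, coprime_mod_of_dvd _ _ _ (dvd_mul_right ..) h1,
      isCoprime_emod_shift _ _ _ _ _ (dvd_mul_right ..) h2⟩,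
      ⟨Nat.mod_lt _ hb, coprime_mod_of_dvd _ _ _ (dvd_mul_left ..) h1,
      isCoprime_emod_shift _ _ _ _ _ (dvd_mul_left ..) h2⟩⟩
  · intro x hx y hy hxy
    simp only [coe_filter, Set.mem_ofPred_eq, Finset.mem_range] at hx hy
    simp only [Prod.mk.injEq] at hxy
    have : x ≡ y [MOD a * b] := (Nat.modEq_and_modEq_iff_modEq_mul hab).mp ⟨hxy.1, hxy.2⟩
    exact Nat.ModEq.eq_of_lt_of_lt this hx.1 hy.1

lemma FF_pp_le (p e M : ℕ) (k : ℤ) (pp : p.Prime) :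
    FF (p ^ (e+1)) M k ≤ FF p M k * p ^ e := by
  unfold FF
  rw [← card_range (p ^ e), ← card_product]
  refine card_le_card_of_injOn (fun x => (x % p, x / p)) ?_ ?_
  · intro x hx
    simp only [coe_filter, Set.mem_ofPred_eq, Finset.mem_range] at hx
    obtain ⟨hx, h1, h2⟩ := hx
    have hd : p ∣ p ^ (e+1) := dvd_pow_self _ (by omega)
    simp only [coe_product, Set.mem_prod, coe_filter, Set.mem_ofPred_eq, Finset.mem_range, coe_range,
      Set.mem_Iio]
    exact ⟨⟨Nat.mod_lt _ pp.pos, coprime_mod_of_dvd _ _ _ hd h1,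
      isCoprime_emod_shift _ _ _ _ _ hd h2⟩, 
       by rw [Nat.div_lt_iff_lt_mul pp.pos]; rwa [pow_succ] at hx⟩
  · intro x hx y hy hxy
    simp only [Prod.mk.injEq] at hxy
    rw [← Nat.mod_add_div x p, ← Nat.mod_add_div y p, hxy.1, hxy.2]

lemma FF_p1 (p M : ℕ) (k : ℤ) (pp : p.Prime) : FF p M k ≤ p - 1 := by
  unfold FF
  calc _ ≤ ((range p).erase 0).card := by
        apply card_le_card
        intro x hx
        simp only [mem_filter, Finset.mem_range, mem_erase] at hx ⊢
        refine ⟨?_, hx.1⟩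
        rintro rfl
        have := hx.2.1
        simp at this
        exact pp.one_lt.ne' this
    _ = p - 1 := by rw [card_erase_of_mem (by simpa using pp.pos)]; simp

lemma FF_p2 (p M : ℕ) (k : ℤ) (pp : p.Prime) (hM : ¬ p ∣ M) (hk : ¬ (p : ℤ) ∣ k) : FF p M k ≤ p - 2 := by
  have cM : IsCoprime (M : ℤ) (p : ℤ) :=
    Nat.isCoprime_iff_coprime.mpr ((Nat.Prime.coprime_iff_not_dvd pp).mpr hM).symm
  have pz : Prime (p : ℤ) := Nat.prime_iff_prime_int.mp pp
  have p0 : (p : ℤ) ≠ 0 := by exact_mod_cast pp.ne_zero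
  obtain ⟨u, v, huv⟩ := cM
  set y : ℕ := ((u * k) % p).toNat with hy
  have hyz : (y : ℤ) = (u * k) % p := Int.toNat_of_nonneg (Int.emod_nonneg _ p0)
  have hyd : (y : ℤ) = u * k - p * ((u*k) / p) := by
    rw [hyz, Int.emod_def]
  have hylt : y < p := by
    have := Int.emod_lt_of_pos (u * k) (b := (p : ℤ)) (by exact_mod_cast pp.pos)
    rw [← hyz] at this; exact_mod_cast this
  have hdv : (p : ℤ) ∣ y * M - k := by
    refine ⟨- (u*k/p) * M - v * k, ?_⟩
    rw [hyd]
    linear_combination k * huv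
  have hy0 : y ≠ 0 := by
    intro h
    rw [h] at hdv
    simp at hdv
    exact hk hdv
  unfold FF
  calc _ ≤ (((range p).erase 0).erase y).card := by
        apply card_le_card
        intro x hx
        simp only [mem_filter, Finset.mem_range, mem_erase] at hx ⊢
        refine ⟨?_, ?_, hx.1⟩
        · rintro rfl
          exact pz.not_isUnit (hx.2.2.isUnit_of_dvd' hdv dvd_rfl)
        · rintro rfl
          have := hx.2.1
          simp at this
          exact pp.one_lt.ne' this
    _ = p - 2 := by
        rw [card_erase_of_mem (by simp [hy0, hylt]), card_erase_of_mem (by simpa using pp.pos)]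
        simp; omega

lemma FF_bound (M : ℕ) (k : ℤ) : ∀ r : ℕ, 0 < r → r.Coprime M →
    (FF r M k : ℝ) ≤ (r.totient : ℝ) ^ 2 / r * ((k.natAbs.gcd r : ℕ) / (Nat.totient (k.natAbs.gcd r) : ℝ)) := by
  intro r
  induction r using Nat.recOnPosPrimePosCoprime with
  | prime_pow p n pp hn =>
    intro _ hcM
    obtain ⟨e, rfl⟩ : ∃ e, n = e + 1 := ⟨n - 1, by omega⟩
    have hpM : ¬ p ∣ M := (Nat.Prime.coprime_iff_not_dvd pp).mp (Nat.Coprime.coprime_dvd_left (dvd_pow_self _ (by omega)) hcM)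
    have h1 : (FF (p^(e+1)) M k : ℝ) ≤ FF p M k * (p:ℝ)^e := by exact_mod_cast FF_pp_le p e M k pp
    have ppos : (0:ℝ) < p := by exact_mod_cast pp.pos
    have p1 : (1:ℝ) < p := by exact_mod_cast pp.one_lt
    have htot : (Nat.totient (p^(e+1)) : ℝ) = p ^ e * (p - 1) := by
      rw [Nat.totient_prime_pow_succ pp]; push_cast [Nat.cast_sub pp.one_lt.le]; ring
    by_cases hk : (p : ℤ) ∣ k
    · have hk' : p ∣ k.natAbs := Int.natCast_dvd.mp hk
      obtain ⟨i, hi, hg⟩ := (Nat.dvd_prime_pow pp).mp (Nat.gcd_dvd_right k.natAbs (p^(e+1)))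
      have hi0 : i ≠ 0 := by
        rintro rfl
        have : p ∣ k.natAbs.gcd (p^(e+1)) := Nat.dvd_gcd hk' (dvd_pow_self _ (by omega))
        rw [hg] at this
        exact pp.one_lt.ne' (by simpa using this)
      obtain ⟨i, rfl⟩ : ∃ j, i = j + 1 := ⟨i - 1, by omega⟩
      have htot2 : (Nat.totient (p^(i+1)) : ℝ) = p ^ i * (p - 1) := by
        rw [Nat.totient_prime_pow_succ pp]; push_cast [Nat.cast_sub pp.one_lt.le]; ring
      rw [hg, htot, htot2]
      have h2 : (FF p M k : ℝ) ≤ p - 1 := by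
        have : (FF p M k : ℝ) ≤ ((p - 1 : ℕ) : ℝ) := by exact_mod_cast FF_p1 p M k pp
        rwa [Nat.cast_sub pp.one_lt.le, Nat.cast_one] at this
      have h3 : ((p:ℝ) ^ e * (p - 1))^2 / ((p^(e+1) : ℕ) : ℝ) * (((p^(i+1) : ℕ) : ℝ) / (p ^ i * (p - 1))) = (p - 1) * (p:ℝ)^e := by
        have : (p:ℝ) - 1 ≠ 0 := by linarith
        push_cast
        field_simp
        ring
      rw [h3]
      exact h1.trans (by gcongr)
    · have hg : k.natAbs.gcd (p^(e+1)) = 1 := by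
        apply Nat.Coprime.pow_right
        exact ((Nat.Prime.coprime_iff_not_dvd pp).mpr (fun h => hk (Int.natCast_dvd.mpr h))).symm
      rw [hg, htot]
      have h2 : (FF p M k : ℝ) ≤ p - 2 := by
        have : (FF p M k : ℝ) ≤ ((p - 2 : ℕ) : ℝ) := by exact_mod_cast FF_p2 p M k pp hpM hk
        rwa [Nat.cast_sub pp.two_le, Nat.cast_ofNat] at this
      have h3 : ((p:ℝ) ^ e * (p - 1))^2 / ((p^(e+1) : ℕ) : ℝ) * (((1 : ℕ) : ℝ) / (Nat.totient 1 : ℝ)) = ((p-1)^2/p) * (p:ℝ)^e := by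
        push_cast
        simp
        field_simp
        ring
      rw [h3]
      refine h1.trans ?_
      gcongr
      refine h2.trans ?_
      rw [le_div_iff₀ ppos]
      nlinarith
  | zero => intro h; exact absurd h (lt_irrefl _)
  | one =>
    intro _ _
    simp only [Nat.totient_one, Nat.gcd_one_right]
    have : FF 1 M k ≤ 1 := by
      unfold FF
      exact (card_filter_le _ _).trans (by simp)
    simpa using this
  | coprime a b ha hb hab iha ihb =>
    intro _ hcM
    have ha' := iha (by omega) (Nat.Coprime.coprime_mul_right hcM)
    have hb' := ihb (by omega) (Nat.Coprime.coprime_mul_left hcM)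
    have h := FF_mul a b M k hab (by omega) (by omega)
    have h' : (FF (a*b) M k : ℝ) ≤ FF a M k * FF b M k := by exact_mod_cast h
    refine h'.trans ((mul_le_mul ha' hb' (by positivity) (by positivity)).trans_eq ?_)
    have hg : (k.natAbs.gcd a).Coprime (k.natAbs.gcd b) := Nat.Coprime.coprime_dvd_left (Nat.gcd_dvd_right ..) (Nat.Coprime.coprime_dvd_right (Nat.gcd_dvd_right ..) hab)
    rw [Nat.Coprime.gcd_mul _ hab, Nat.totient_mul hab, Nat.totient_mul hg]
    push_cast
    ring
open scoped ArithmeticFunction.sigma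

lemma prod_Icc_half (N : ℕ) (hN : 1 ≤ N) :
    ∏ k ∈ Icc 2 N, (1 - 1 / (k : ℝ) ^ 2) = ((N:ℝ) + 1) / (2 * N) := by
  induction N, hN using Nat.le_induction with
  | base => norm_num
  | succ n hn ih =>
    rw [prod_Icc_succ_top (by omega), ih]
    have : (0:ℝ) < n := by exact_mod_cast hn
    push_cast
    field_simp
    ring

lemma prod_primes_half (g : ℕ) (hg : 0 < g) :
    (1:ℝ) / 2 ≤ ∏ p ∈ g.primeFactors, (1 - 1 / (p : ℝ) ^ 2) := by
  have h01 : ∀ k : ℕ, 2 ≤ k → 0 ≤ (1 - 1 / (k : ℝ) ^ 2) ∧ (1 - 1 / (k : ℝ) ^ 2) ≤ 1 := by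
    intro k hk
    have : (2:ℝ) ≤ k := by exact_mod_cast hk
    constructor
    · rw [sub_nonneg, div_le_one (by positivity)]; nlinarith
    · have : 0 ≤ 1 / (k:ℝ)^2 := by positivity
      linarith
  have hsub : g.primeFactors ⊆ Icc 2 g := by
    intro p hp
    have := Nat.prime_of_mem_primeFactors hp
    exact Finset.mem_Icc.mpr ⟨this.two_le, Nat.le_of_mem_primeFactors hp⟩
  calc (1:ℝ)/2 ≤ (g + 1) / (2 * g) := by
        have : (0:ℝ) < g := by exact_mod_cast hg
        rw [div_le_div_iff₀ (by norm_num) (by positivity)]; linarith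
    _ = ∏ k ∈ Icc 2 g, (1 - 1 / (k : ℝ) ^ 2) := (prod_Icc_half g hg).symm
    _ ≤ _ := by
        rw [← prod_sdiff hsub]
        refine mul_le_of_le_one_left (prod_nonneg fun p hp => (h01 p (Finset.mem_Icc.mp (hsub hp)).1).1) ?_
        refine prod_le_one (fun p hp => ?_) (fun p hp => ?_)
        · exact (h01 p (Finset.mem_Icc.mp (Finset.sdiff_subset hp)).1).1
        · exact (h01 p (Finset.mem_Icc.mp (Finset.sdiff_subset hp)).1).2

lemma phi_sigma (g : ℕ) : 0 < g →
    (g:ℝ)^2 * ∏ p ∈ g.primeFactors, (1 - 1 / (p : ℝ) ^ 2) ≤ g.totient * (σ 1 g : ℕ) := by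
  induction g using Nat.recOnPosPrimePosCoprime with
  | prime_pow p n pp hn =>
    intro _
    obtain ⟨e, rfl⟩ : ∃ e, n = e + 1 := ⟨n - 1, by omega⟩
    rw [Nat.primeFactors_prime_pow (by omega) pp, prod_singleton]
    have ppos : (0:ℝ) < p := by exact_mod_cast pp.pos
    have p1 : (1:ℝ) < p := by exact_mod_cast pp.one_lt
    have htot : (Nat.totient (p^(e+1)) : ℝ) = p ^ e * (p - 1) := by
      rw [Nat.totient_prime_pow_succ pp]; push_cast [Nat.cast_sub pp.one_lt.le]; ring
    have hs : (p:ℝ)^e + p^(e+1) ≤ (σ 1 (p^(e+1)) : ℕ) := by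
      have : p ^ e + p ^(e+1) ≤ σ 1 (p^(e+1)) := by
        rw [ArithmeticFunction.sigma_one_apply_prime_pow pp, sum_range_succ, sum_range_succ]
        omega
      exact_mod_cast this
    rw [htot]
    calc _ = (p:ℝ)^e * (p-1) * (p^e + p^(e+1)) := by push_cast; field_simp; ring
      _ ≤ _ := by
        have : (0:ℝ) ≤ p - 1 := by linarith
        gcongr
  | zero => intro h; exact absurd h (lt_irrefl _)
  | one => intro _; simp
  | coprime a b ha hb hab iha ihb =>
    intro _
    have ha' := iha (by omega)
    have hb' := ihb (by omega)
    rw [hab.primeFactors_mul, prod_union hab.disjoint_primeFactors, Nat.totient_mul hab, ArithmeticFunction.isMultiplicative_sigma.map_mul_of_coprime hab]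
    have := prod_primes_half b (by omega)
    have hnn : 0 ≤ (b:ℝ)^2 * ∏ p ∈ b.primeFactors, (1 - 1 / (p : ℝ) ^ 2) := by positivity
    have := mul_le_mul ha' hb' hnn (by positivity)
    push_cast
    calc _ = _ := by ring
      _ ≤ _ := this
      _ = _ := by ring

lemma sum_inv_div (g : ℕ) : ((σ 1 g : ℕ) : ℝ) = g * ∑ d ∈ g.divisors, 1 / (d:ℝ) := by
  rw [ArithmeticFunction.sigma_one_apply, ← Nat.sum_div_divisors, mul_sum, Nat.cast_sum]
  refine sum_congr rfl fun d hd => ?_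
  have hd' := Nat.dvd_of_mem_divisors hd
  have : (d:ℝ) ≠ 0 := by exact_mod_cast (Nat.pos_of_mem_divisors hd).ne'
  rw [Nat.cast_div hd' this]; ring

lemma g_over_phi (g k : ℕ) (hk : 0 < k) (hgk : g ∣ k) :
    (g:ℝ) / g.totient ≤ 2 * ∑ d ∈ k.divisors, 1 / (d:ℝ) := by
  have hg : 0 < g := Nat.pos_of_dvd_of_pos hgk hk
  have h1 := phi_sigma g hg
  have h2 := prod_primes_half g hg
  rw [sum_inv_div g] at h1
  have h3 : ∑ d ∈ g.divisors, 1 / (d:ℝ) ≤ ∑ d ∈ k.divisors, 1 / (d:ℝ) :=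
    sum_le_sum_of_subset_of_nonneg (Nat.divisors_subset_of_dvd hk.ne' hgk) (fun _ _ _ => by positivity)
  refine le_trans ?_ (mul_le_mul_of_nonneg_left h3 (by norm_num))
  have hφ : (0:ℝ) < g.totient := by exact_mod_cast Nat.totient_pos.mpr hg
  have hg' : (0:ℝ) < g := by exact_mod_cast hg
  rw [div_le_iff₀ hφ]
  have h4 : (g:ℝ)^2 * (1/2) ≤ g.totient * (g * ∑ d ∈ g.divisors, 1 / (d:ℝ)) :=
    (mul_le_mul_of_nonneg_left h2 (by positivity)).trans h1
  have : (g:ℝ) * (g * (1/2)) ≤ g * (g.totient * ∑ d ∈ g.divisors, 1 / (d:ℝ)) := by linarith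
  have := le_of_mul_le_mul_left this hg'
  linarith

lemma sum_swap (t K : ℕ) :
    ∑ k ∈ (Icc 1 K).filter (fun b => Nat.Coprime b t), ∑ d ∈ k.divisors, 1 / (d:ℝ)
     ≤ ∑ j ∈ (Icc 1 K).filter (fun b => Nat.Coprime b t), ∑ d ∈ Icc 1 (K / j), 1 / (d:ℝ) := by
  rw [sum_sigma', sum_sigma']
  set e : (Σ _ : ℕ, ℕ) → (Σ _ : ℕ, ℕ) := fun x => ⟨x.1 / x.2, x.2⟩ with he
  have hinj : Set.InjOn e (((Icc 1 K).filter (fun b => Nat.Coprime b t)).sigma fun k => k.divisors) := by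
    rintro ⟨k, d⟩ hx ⟨k', d'⟩ hy hxy
    simp only [coe_sigma, Set.mem_sigma_iff, Finset.mem_coe, Nat.mem_divisors] at hx hy
    simp only [he, Sigma.mk.injEq, heq_eq_eq] at hxy
    obtain ⟨h1, rfl⟩ := hxy
    have : k = k' := by
      rw [← Nat.div_mul_cancel hx.2.1, ← Nat.div_mul_cancel hy.2.1, h1]
    subst this
    rfl
  calc _ = ∑ x ∈ (((Icc 1 K).filter (fun b => Nat.Coprime b t)).sigma fun k => k.divisors).image e, 1 / (x.2 : ℝ) := by
        rw [sum_image hinj]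
    _ ≤ _ := by
        refine sum_le_sum_of_subset_of_nonneg ?_ (fun _ _ _ => by positivity)
        intro y hy
        rw [mem_image] at hy
        obtain ⟨⟨k, d⟩, hx, rfl⟩ := hy
        simp only [mem_sigma, mem_filter, Finset.mem_Icc, Nat.mem_divisors] at hx
        obtain ⟨⟨⟨k1, k2⟩, k3⟩, hd, hk⟩ := hx
        have hd0 : 0 < d := Nat.pos_of_dvd_of_pos hd k1
        have hq : 0 < k / d := Nat.div_pos (Nat.le_of_dvd k1 hd) hd0
        simp only [he, mem_sigma, mem_filter, Finset.mem_Icc]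
        refine ⟨⟨⟨hq, (Nat.div_le_self _ _).trans k2⟩, k3.coprime_dvd_left (Nat.div_dvd_of_dvd hd)⟩, hd0, ?_⟩
        rw [Nat.le_div_iff_mul_le hq, Nat.mul_div_cancel' hd]
        exact k2

lemma harm (X : ℝ) (j : ℕ) (hj : 1 ≤ j) (hjX : j ≤ X) :
    ∑ d ∈ Icc 1 (⌊X⌋₊ / j), 1 / (d:ℝ) ≤ 2 * Real.log (2 * X / j) := by
  have hj' : (0:ℝ) < j := by exact_mod_cast hj
  have h1 := harmonic_floor_le_one_add_log (X / j) ((one_le_div hj').mpr hjX)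
  rw [harmonic_eq_sum_Icc, Nat.floor_div_natCast] at h1
  push_cast at h1
  simp only [one_div]
  refine h1.trans ?_
  have h2 : 2 * X / j = 2 * (X / j) := by ring
  have hxj : 1 ≤ X / j := (one_le_div hj').mpr hjX
  rw [h2, Real.log_mul (by norm_num) (by positivity)]
  have := Real.log_two_gt_d9
  have := Real.log_nonneg hxj
  linarith

lemma S_eq (t : ℕ) (Y θ : ℝ) (h : θ ≤ Y) (h1 : 0 ≤ θ) :
    S t θ = ∑ b ∈ (Icc 1 ⌊Y⌋₊).filter (fun b => Nat.Coprime b t), Set.indicator (Set.Ici (b:ℝ)) (fun x => x⁻¹) θ := by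
  unfold S
  rw [div_eq_mul_inv, ← nsmul_eq_mul, ← sum_const]
  simp only [Set.indicator_apply, Set.mem_Ici]
  rw [← sum_filter]
  refine sum_congr ?_ (fun _ _ => rfl)
  ext b
  simp only [mem_filter, Finset.mem_Icc]
  have e1 : b ≤ ⌊θ⌋₊ ↔ (b:ℝ) ≤ θ := Nat.le_floor_iff h1
  have e2 : b ≤ ⌊Y⌋₊ ↔ (b:ℝ) ≤ Y := Nat.le_floor_iff (h1.trans h)
  rw [e1, e2]
  constructor
  · rintro ⟨⟨a1, a2⟩, a3⟩
    exact ⟨⟨⟨a1, a2.trans h⟩, a3⟩, a2⟩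
  · rintro ⟨⟨⟨a1, a2⟩, a3⟩, a4⟩
    exact ⟨⟨a1, a4⟩, a3⟩

lemma S_int (t : ℕ) (X : ℝ) (hX : 1 ≤ X) :
    ∑ b ∈ (Icc 1 ⌊X⌋₊).filter (fun b => Nat.Coprime b t), Real.log (2 * X / b) ≤ ∫ θ in (1:ℝ)..(2*X), S t θ := by
  have e : ∫ θ in (1:ℝ)..(2*X), S t θ = ∫ θ in (1:ℝ)..(2*X), ∑ b ∈ (Icc 1 ⌊2*X⌋₊).filter (fun b => Nat.Coprime b t), Set.indicator (Set.Ici (b:ℝ)) (fun x => x⁻¹) θ := by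
    refine intervalIntegral.integral_congr fun θ hθ => ?_
    rw [Set.uIcc_of_le (by linarith)] at hθ
    exact S_eq t _ θ hθ.2 (by linarith [hθ.1])
  have hint0 : IntervalIntegrable (fun x : ℝ => x⁻¹) volume 1 (2*X) := by
    refine intervalIntegral.intervalIntegrable_inv (fun x hx => ?_) continuousOn_id
    rw [Set.uIcc_of_le (by linarith)] at hx
    have := hx.1
    linarith
  have hint : ∀ b : ℕ, IntervalIntegrable (Set.indicator (Set.Ici (b:ℝ)) (fun x => x⁻¹)) volume 1 (2*X) := by
    intro b
    rw [intervalIntegrable_iff] at hint0 ⊢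
    exact hint0.indicator measurableSet_Ici
  rw [e, intervalIntegral.integral_finsetSum (fun b _ => hint b)]
  have hnn : ∀ b : ℕ, ∀ c, 1 ≤ c →  c ≤ 2 * X → 0 ≤ ∫ θ in c..(2*X), Set.indicator (Set.Ici (b:ℝ)) (fun x => x⁻¹) θ := by
    intro b c hc1 hc
    refine intervalIntegral.integral_nonneg hc (fun x hx => ?_)
    apply Set.indicator_apply_nonneg
    intro _
    have := hx.1
    have : 0 < x := by linarith
    positivity
  refine le_trans ?_ (sum_le_sum_of_subset_of_nonneg (s := (Icc 1 ⌊X⌋₊).filter (fun b => Nat.Coprime b t)) ?_ ?_)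
  · refine sum_le_sum fun b hb => ?_
    simp only [mem_filter, Finset.mem_Icc] at hb
    have hb1 : (1:ℝ) ≤ b := by exact_mod_cast hb.1.1
    have hb2 : (b:ℝ) ≤ X := (Nat.le_floor_iff (by linarith)).mp hb.1.2
    have hi1 : IntervalIntegrable (Set.indicator (Set.Ici (b:ℝ)) (fun x => x⁻¹)) volume 1 b := by
      refine (hint b).mono_set ?_
      rw [Set.uIcc_of_le hb1, Set.uIcc_of_le (by linarith)]
      exact Set.Icc_subset_Icc_right (by linarith)
    have hi2 : IntervalIntegrable (Set.indicator (Set.Ici (b:ℝ)) (fun x => x⁻¹)) volume b (2*X) := by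
      refine (hint b).mono_set ?_
      rw [Set.uIcc_of_le (by linarith), Set.uIcc_of_le (by linarith)]
      exact Set.Icc_subset_Icc_left (by linarith)
    rw [← intervalIntegral.integral_add_adjacent_intervals hi1 hi2]
    have h1 : 0 ≤ ∫ θ in (1:ℝ)..b, Set.indicator (Set.Ici (b:ℝ)) (fun x => x⁻¹) θ := by
      refine intervalIntegral.integral_nonneg hb1 (fun x hx => ?_)
      apply Set.indicator_apply_nonneg
      intro _
      have := hx.1
      have : 0 < x := by linarith
      positivity
    have h2 : ∫ θ in (b:ℝ)..(2*X), Set.indicator (Set.Ici (b:ℝ)) (fun x => x⁻¹) θ = Real.log (2 * X / b) := by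
      rw [← integral_inv_of_pos (by linarith) (by linarith)]
      refine intervalIntegral.integral_congr fun θ hθ => ?_
      rw [Set.uIcc_of_le (by linarith)] at hθ
      exact Set.indicator_of_mem hθ.1 _
    linarith
  · refine filter_subset_filter _ (Finset.Icc_subset_Icc_right (Nat.floor_mono (by linarith)))
  · intro b _ _
    exact hnn b 1 le_rfl (by linarith)

lemma main_sum (t : ℕ) (X : ℝ) :
    ∑ k ∈ (Icc 1 ⌊X⌋₊).filter (fun b => Nat.Coprime b t), ∑ d ∈ k.divisors, 1 / (d:ℝ) ≤ 
      2 * ∫ θ in (1:ℝ)..(max 1 (2*X)), S t θ := by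
  by_cases hX : 1 ≤ X
  · rw [max_eq_right (by linarith)]
    refine (sum_swap t _).trans (le_trans ?_ (mul_le_mul_of_nonneg_left (S_int t X hX) (by norm_num)))
    rw [mul_sum]
    refine sum_le_sum fun j hj => ?_
    simp only [mem_filter, Finset.mem_Icc] at hj
    exact harm X j hj.1.1 ((Nat.le_floor_iff (by linarith)).mp hj.1.2)
  · have : ⌊X⌋₊ = 0 := Nat.floor_eq_zero.mpr (by linarith)
    rw [this]
    simp only [zero_lt_one, Finset.Icc_eq_empty_of_lt, filter_empty, sum_empty]
    refine mul_nonneg (by norm_num) (intervalIntegral.integral_nonneg (le_max_left _ _) fun x hx => ?_)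
    unfold S
    have := hx.1
    positivity

noncomputable def AA (m : ℕ) : Finset ℕ := (Icc 1 m).filter (fun a => Nat.Coprime a m)

noncomputable def PP (r s M N : ℕ) (k : ℤ) : Finset (ℕ × ℕ) :=
  (AA (r * N * s) ×ˢ AA (r * M * s)).filter
    (fun x => ((M * N * s * r : ℕ) : ℤ) ∣ (x.1 : ℤ) * M - (x.2 : ℤ) * N - k)

lemma eq_of_Icc_dvd (m a a' : ℕ) (h : a ∈ Icc 1 m) (h' : a' ∈ Icc 1 m) (hd : (m : ℤ) ∣ (a : ℤ) - a') :
    a = a' := by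
  rw [Finset.mem_Icc] at h h'
  have := Int.eq_zero_of_abs_lt_dvd hd (by rw [abs_lt]; omega)
  omega

lemma PP_card (r s M N : ℕ) (k : ℤ) (hMN : Nat.Coprime M N) (hrN : Nat.Coprime r (M * N))
    (hrs : Nat.Coprime r s) (hp : ∀ p : ℕ, p.Prime → p ∣ s → p ∣ M * N) (hM : 0 < M) (hN : 0 < N)
    (hr : 0 < r) (hs : 0 < s) :
    (PP r s M N k).card ≤ s.totient * FF r M k := by
  have htot : s.totient = ((range s).filter (fun x => s.Coprime x)).card := rfl
  rw [htot]
  unfold FF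
  rw [← card_product]
  refine card_le_card_of_injOn (fun x => (x.1 * x.2 % s, x.1 % r)) ?_ ?_
  · rintro ⟨a, b⟩ hx
    simp only [PP, AA, mem_coe, mem_filter, mem_product] at hx
    obtain ⟨⟨⟨_, ha⟩, ⟨_, hb⟩⟩, hd⟩ := hx
    simp only [mem_coe, mem_filter, mem_product, Finset.mem_range]
    refine ⟨⟨Nat.mod_lt _ hs, ?_⟩, Nat.mod_lt _ hr, ?_, ?_⟩
    · refine (coprime_mod_of_dvd _ _ _ dvd_rfl (Nat.Coprime.mul_left ?_ ?_)).symm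
      · exact ha.coprime_dvd_right (dvd_mul_left ..)
      · exact hb.coprime_dvd_right (dvd_mul_left ..)
    · exact coprime_mod_of_dvd _ _ _ ⟨N * s, by ring⟩ ha
    · refine isCoprime_emod_shift _ _ _ _ _ dvd_rfl ?_
      obtain ⟨w, hw⟩ := hd
      push_cast at hw
      have h1 : (a : ℤ) * M - k = ((b * N : ℕ) : ℤ) + (r : ℤ) * (M * N * s * w) := by
        push_cast; linear_combination hw
      rw [h1]
      refine IsCoprime.add_mul_left_left ?_ _
      refine Nat.isCoprime_iff_coprime.mpr (Nat.Coprime.mul_left ?_ ?_)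
      · exact hb.coprime_dvd_right ⟨M * s, by ring⟩
      · exact (hrN.coprime_dvd_right (dvd_mul_left ..)).symm
  · rintro ⟨a, b⟩ hx ⟨a', b'⟩ hy hxy
    simp only [PP, AA, mem_coe, mem_filter, mem_product] at hx hy
    obtain ⟨⟨⟨ha1, ha⟩, ⟨hb1, hb⟩⟩, hd⟩ := hx
    obtain ⟨⟨⟨ha1', ha'⟩, ⟨hb1', hb'⟩⟩, hd'⟩ := hy
    simp only [Prod.mk.injEq] at hxy
    have key := core_inj r s M N hMN hrN hrs hp hM hN a a' b b'
      (Nat.isCoprime_iff_coprime.mpr (ha.coprime_dvd_right (dvd_mul_left ..)))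
      (Nat.isCoprime_iff_coprime.mpr (hb'.coprime_dvd_right (dvd_mul_left ..)))
      (by have := dvd_sub hd hd'; ring_nf at this ⊢; exact this)
      (by have := (Nat.modEq_iff_dvd.mp (show a' * b' ≡ a * b [MOD s] from hxy.1.symm)); exact_mod_cast this)
      (Nat.modEq_iff_dvd.mp (show a' ≡ a [MOD r] from hxy.2.symm))
    rw [eq_of_Icc_dvd _ a a' ha1 ha1' key.1, eq_of_Icc_dvd _ b b' hb1 hb1' key.2]

lemma PP_coprime (r s M N : ℕ) (k : ℤ) (hMN : Nat.Coprime M N) 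
    (hp : ∀ p : ℕ, p.Prime → p ∣ s → p ∣ M * N)
    (x : ℕ × ℕ) (hx : x ∈ PP r s M N k) : k.natAbs.Coprime (M * N * s) := by
  obtain ⟨a, b⟩ := x
  simp only [PP, AA, mem_filter, mem_product] at hx
  obtain ⟨⟨⟨_, ha⟩, ⟨_, hb⟩⟩, hd⟩ := hx
  rw [Nat.coprime_iff_gcd_eq_one]
  by_contra hne
  obtain ⟨p, pp, hpd⟩ := Nat.exists_prime_and_dvd hne
  have hpt : p ∣ M * N * s := hpd.trans (Nat.gcd_dvd_right ..)
  have hpk : (p : ℤ) ∣ k := Int.natCast_dvd.mpr (hpd.trans (Nat.gcd_dvd_left ..))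
  have pz : Prime (p : ℤ) := Nat.prime_iff_prime_int.mp pp
  have hMN' : p ∣ M * N := by
    rcases pp.dvd_mul.mp hpt with h | h
    · exact h
    · exact hp p pp h
  have hnot : ∀ x y : ℕ, x.Coprime y → p ∣ x → p ∣ y → False := fun x y h h1 h2 =>
    pp.one_lt.ne' (Nat.dvd_one.mp (h ▸ Nat.dvd_gcd h1 h2))
  have h1 : (p : ℤ) ∣ (a : ℤ) * M - (b : ℤ) * N := by
    have h2 : (p : ℤ) ∣ ((M * N * s * r : ℕ) : ℤ) := by exact_mod_cast hpt.mul_right r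
    have := dvd_add (h2.trans hd) hpk
    simpa using this
  rcases pp.dvd_mul.mp hMN' with h | h
  · have h3 : (p:ℤ) ∣ ((b * N : ℕ) : ℤ) := by
      push_cast
      exact (dvd_sub_right (Dvd.dvd.mul_left (by exact_mod_cast h) _)).mp h1
    rcases pp.dvd_mul.mp (by exact_mod_cast h3) with h4 | h4
    · exact hnot b _ hb h4 (h.trans ⟨r * s, by ring⟩)
    · exact hnot _ _ hMN h h4
  · have h3 : (p:ℤ) ∣ ((a * M : ℕ) : ℤ) := by
      push_cast
      exact (dvd_sub_left (Dvd.dvd.mul_left (by exact_mod_cast h) _)).mp h1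
    rcases pp.dvd_mul.mp (by exact_mod_cast h3) with h4 | h4
    · exact hnot a _ ha h4 (h.trans ⟨r * s, by ring⟩)
    · exact hnot _ _ hMN h4 h

open Classical in
noncomputable def QQ (m n : ℕ) (D : ℝ) : Finset (ℕ × ℕ) :=
  (AA m ×ˢ AA n).filter (fun x => ∃ z : ℤ, |(x.1 : ℝ) / m - (x.2 : ℝ) / n - z| ≤ D)

lemma QQ_card (r s M N : ℕ) (D : ℝ) (hMN : Nat.Coprime M N) (hrN : Nat.Coprime r (M * N))
    (hrs : Nat.Coprime r s) (hp : ∀ p : ℕ, p.Prime → p ∣ s → p ∣ M * N) (hM : 0 < M) (hN : 0 < N)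
    (hr : 0 < r) (hs : 0 < s) (ht : M * N * s ≠ 1) :
    ((QQ (r * N * s) (r * M * s) D).card : ℝ) ≤ 8 * s.totient * ((r.totient : ℝ)^2 / r) *
      ∫ θ in (1:ℝ)..(max 1 (2*(D * r * (M * N * s : ℕ)))), S (M * N * s) θ := by
  classical
  set t := M * N * s with ht'
  set X := D * r * (t : ℕ) with hX
  have hrR : (0:ℝ) < r := by exact_mod_cast hr
  have hsR : (0:ℝ) < s := by exact_mod_cast hs
  have hMR : (0:ℝ) < M := by exact_mod_cast hM
  have hNR : (0:ℝ) < N := by exact_mod_cast hN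
  have hsub : QQ (r * N * s) (r * M * s) D ⊆ ((Icc 1 ⌊X⌋₊).filter (fun b => Nat.Coprime b t)).biUnion
      (fun j => PP r s M N j ∪ PP r s M N (-j)) := by
    rintro ⟨a, b⟩ hx
    simp only [QQ, mem_filter] at hx
    obtain ⟨hab, z, hz⟩ := hx
    set k : ℤ := a * M - b * N - z * (M * N * s * r : ℕ) with hk
    have hkP : (a, b) ∈ PP r s M N k := by
      simp only [PP, mem_filter]
      exact ⟨hab, ⟨z, by rw [hk]; ring⟩⟩
    have hcop := PP_coprime r s M N k hMN hp _ hkP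
    have hk0 : k.natAbs ≠ 0 := by
      intro h
      rw [h] at hcop
      exact ht ((Nat.coprime_zero_left _).mp hcop)
    have hkX : (k.natAbs : ℝ) ≤ X := by
      have h1 : (k.natAbs : ℝ) = |(k : ℝ)| := by rw [Nat.cast_natAbs]; simp
      have h2 : (k : ℝ) = (r * t) * ((a : ℝ) / (r * N * s : ℕ) - (b : ℝ) / (r * M * s : ℕ) - z) := by
        rw [hk, ht']; push_cast; field_simp
      rw [h1, h2, abs_mul, abs_of_nonneg (by positivity), hX]
      calc _ ≤ (r * t : ℝ) * D := by gcongr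
        _ = _ := by ring
    rw [mem_biUnion]
    refine ⟨k.natAbs, ?_, ?_⟩
    · rw [mem_filter, Finset.mem_Icc]
      exact ⟨⟨by omega, Nat.le_floor hkX⟩, hcop⟩
    · rw [mem_union]
      rcases Int.natAbs_eq k with h | h
      · left; rw [← h]; exact hkP
      · right; rw [← h]; exact hkP
  have hPP : ∀ j : ℕ, 0 < j → ∀ k : ℤ, k.natAbs = j → ((PP r s M N k).card : ℝ) ≤ s.totient * ((r.totient : ℝ)^2 / r) * (2 * ∑ d ∈ j.divisors, 1 / (d:ℝ)) := by
    intro j hj k hkj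
    have h1 : ((PP r s M N k).card : ℝ) ≤ s.totient * FF r M k := by
      exact_mod_cast PP_card r s M N k hMN hrN hrs hp hM hN hr hs
    have h2 := FF_bound M k r hr (hrN.coprime_dvd_right (dvd_mul_right ..))
    rw [hkj] at h2
    have h3 := g_over_phi (j.gcd r) j hj (Nat.gcd_dvd_left ..)
    calc _ ≤ _ := h1
      _ ≤ s.totient * ((r.totient : ℝ) ^ 2 / r * (2 * ∑ d ∈ j.divisors, 1 / (d:ℝ))) := by
        gcongr
        exact h2.trans (by gcongr)
      _ = _ := by ring
  calc ((QQ (r * N * s) (r * M * s) D).card : ℝ) ≤ ((∑ j ∈ (Icc 1 ⌊X⌋₊).filter (fun b => Nat.Coprime b t), ((PP r s M N j).card + (PP r s M N (-j)).card) : ℕ) : ℝ) := by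
        have := (card_le_card hsub).trans (card_biUnion_le.trans (sum_le_sum fun j _ => card_union_le _ _))
        exact_mod_cast this
    _ ≤ ∑ j ∈ (Icc 1 ⌊X⌋₊).filter (fun b => Nat.Coprime b t), 4 * (s.totient * ((r.totient : ℝ)^2 / r)) * ∑ d ∈ j.divisors, 1 / (d:ℝ) := by
        rw [Nat.cast_sum]
        refine sum_le_sum fun j hj => ?_
        rw [mem_filter, Finset.mem_Icc] at hj
        have e1 := hPP j hj.1.1 j (by simp)
        have e2 := hPP j hj.1.1 (-j) (by simp)
        push_cast
        linarith
    _ ≤ 4 * (s.totient * ((r.totient : ℝ)^2 / r)) * (2 * ∫ θ in (1:ℝ)..(max 1 (2*X)), S t θ) := by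
        rw [← mul_sum]
        exact mul_le_mul_of_nonneg_left (main_sum t X) (by positivity)
    _ = _ := by ring

lemma img_sub_ball (c h : ℝ) : (fun y : ℝ => (y : UnitAddCircle)) '' Set.Ioo (c - h) (c + h) ⊆
    Metric.closedBall (c : UnitAddCircle) h := by
  rintro _ ⟨y, hy, rfl⟩
  rw [Metric.mem_closedBall, dist_eq_norm]
  change ‖(y : UnitAddCircle) - (c : UnitAddCircle)‖ ≤ h
  rw [← AddCircle.coe_sub]
  refine (QuotientAddGroup.norm_mk_le_norm).trans ?_
  rw [Real.norm_eq_abs, abs_le]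
  constructor <;> linarith [hy.1, hy.2]

lemma img_vol (c h : ℝ) : volume ((fun y : ℝ => (y : UnitAddCircle)) '' Set.Ioo (c - h) (c + h)) ≤
    ENNReal.ofReal (2 * h) := by
  refine (measure_mono (img_sub_ball c h)).trans ?_
  rw [AddCircle.volume_closedBall]
  exact ENNReal.ofReal_le_ofReal (min_le_right _ _)

lemma E_vol (ψ : ℕ → ℝ) (m n : ℕ) (hm : 0 < ψ m) (hn : 0 < ψ n) :
    (volume (E ψ m ∩ E ψ n)).toReal ≤ (QQ m n (2 * max (ψ m / m) (ψ n / n))).card * 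
      (2 * min (ψ m / m) (ψ n / n)) := by
  classical
  set I : ℕ → ℕ → Set UnitAddCircle := fun m a => (fun y : ℝ => (y : UnitAddCircle)) '' Set.Ioo ((a:ℝ)/m - ψ m / m) ((a:ℝ)/m + ψ m / m) with hI
  have hE : ∀ m, E ψ m = ⋃ a ∈ AA m, I m a := by
    intro m
    simp only [E, AA, hI, sub_div, add_div]
  have hsub : E ψ m ∩ E ψ n ⊆ ⋃ x ∈ QQ m n (2 * max (ψ m / m) (ψ n / n)), (I m x.1 ∩ I n x.2) := by
    rw [hE, hE]
    rintro x ⟨h1, h2⟩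
    simp only [Set.mem_iUnion] at h1 h2 ⊢
    obtain ⟨a, ha, hxa⟩ := h1
    obtain ⟨b, hb, hxb⟩ := h2
    refine ⟨(a, b), ?_, hxa, hxb⟩
    simp only [QQ, mem_filter, mem_product]
    refine ⟨⟨ha, hb⟩, ?_⟩
    obtain ⟨y, hy, rfl⟩ := hxa
    obtain ⟨y', hy', hyy⟩ := hxb
    have hyy' : (y' : UnitAddCircle) = (y : UnitAddCircle) := hyy
    have h0 : ((y' - y : ℝ) : UnitAddCircle) = 0 := by
      rw [AddCircle.coe_sub, hyy', sub_self]
    obtain ⟨z, hz⟩ := (AddCircle.coe_eq_zero_iff (1:ℝ)).mp h0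
    simp only [zsmul_eq_mul, mul_one] at hz
    refine ⟨-z, ?_⟩
    have g1 := le_max_left (ψ m / m) (ψ n / n)
    have g2 := le_max_right (ψ m / m) (ψ n / n)
    have := hy.1
    have := hy.2
    have := hy'.1
    have := hy'.2
    push_cast
    rw [abs_le]
    constructor <;> linarith
  have hvol : volume (E ψ m ∩ E ψ n) ≤ ENNReal.ofReal ((QQ m n (2 * max (ψ m / m) (ψ n / n))).card * 
      (2 * min (ψ m / m) (ψ n / n))) := by
    refine (measure_mono hsub).trans ((measure_biUnion_finset_le _ _).trans ?_)
    rw [ENNReal.ofReal_mul (by positivity), ENNReal.ofReal_natCast, ← nsmul_eq_mul]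
    refine sum_le_card_nsmul _ _ _ fun x _ => ?_
    rcases min_choice (ψ m / m) (ψ n / n) with h | h <;> rw [h]
    · exact (measure_mono Set.inter_subset_left).trans (img_vol _ _)
    · exact (measure_mono Set.inter_subset_right).trans (img_vol _ _)
  refine ENNReal.toReal_le_of_le_ofReal (by positivity) hvol

lemma structure_mn (m n r s t : ℕ) (hm : 0 < m) (hn : 0 < n)
    (hr : r = ∏ p ∈ (m * n).primeFactors.filter
          (fun p => m.factorization p = n.factorization p), p ^ m.factorization p)
    (hs : s = ∏ p ∈ (m * n).primeFactors.filter
          (fun p => m.factorization p ≠ n.factorization p),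
          p ^ min (m.factorization p) (n.factorization p))
    (ht : t = ∏ p ∈ (m * n).primeFactors.filter
          (fun p => m.factorization p ≠ n.factorization p),
          p ^ max (m.factorization p) (n.factorization p)) :
    ∃ M N : ℕ, m = r * N * s ∧ n = r * M * s ∧ t = M * N * s ∧ M.Coprime N ∧ r.Coprime (M * N) ∧
      r.Coprime s ∧ (∀ p : ℕ, p.Prime → p ∣ s → p ∣ M * N) := by
  set B := (m * n).primeFactors.filter (fun p => m.factorization p ≠ n.factorization p) with hB
  have hmn : m * n ≠ 0 := by positivity
  have hfull : ∀ x : ℕ, x ≠ 0 → x ∣ m * n → ∏ p ∈ (m * n).primeFactors, p ^ x.factorization p = x := by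
    intro x hx hxd
    conv_rhs => rw [← Nat.prod_factorization_pow_eq_self hx]
    rw [Finsupp.prod, Nat.support_factorization]
    symm
    refine prod_subset (Nat.primeFactors_mono hxd hmn) ?_
    intro p _ hp
    rw [← Nat.support_factorization, Finsupp.notMem_support_iff] at hp
    rw [hp, pow_zero]
  have hprime : ∀ p ∈ (m * n).primeFactors, p.Prime := fun p hp => Nat.prime_of_mem_primeFactors hp
  have hrB : ∀ e : ℕ → ℕ, r.Coprime (∏ p ∈ B, p ^ e p) := by
    intro e
    rw [hr]
    refine Nat.coprime_prod_left_iff.mpr fun p hp => Nat.coprime_prod_right_iff.mpr fun q hq => ?_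
    rw [mem_filter] at hp hq
    refine Nat.Coprime.pow _ _ ((Nat.coprime_primes (hprime p hp.1) (hprime q hq.1)).mpr ?_)
    rintro rfl
    exact hq.2 hp.2
  refine ⟨∏ p ∈ B, p ^ (n.factorization p - m.factorization p),
    ∏ p ∈ B, p ^ (m.factorization p - n.factorization p), ?_, ?_, ?_, ?_, ?_, ?_, ?_⟩
  · rw [mul_assoc, hs, ← prod_mul_distrib]
    conv_lhs => rw [← hfull m hm.ne' (dvd_mul_right ..)]
    rw [← prod_filter_mul_prod_filter_not _ (fun p => m.factorization p = n.factorization p), hr]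
    congr 1
    refine prod_congr rfl fun p _ => ?_
    rw [← pow_add]; congr 1; omega
  · rw [mul_assoc, hs, ← prod_mul_distrib]
    conv_lhs => rw [← hfull n hn.ne' (dvd_mul_left ..)]
    rw [← prod_filter_mul_prod_filter_not _ (fun p => m.factorization p = n.factorization p), hr]
    congr 1
    · refine prod_congr rfl fun p hp => ?_
      rw [(mem_filter.mp hp).2]
    refine prod_congr rfl fun p _ => ?_
    rw [← pow_add]; congr 1; omega
  · rw [ht, hs, ← prod_mul_distrib, ← prod_mul_distrib]
    refine prod_congr rfl fun p _ => ?_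
    rw [← pow_add, ← pow_add]; congr 1; omega
  · refine Nat.coprime_prod_left_iff.mpr fun p hp => Nat.coprime_prod_right_iff.mpr fun q hq => ?_
    by_cases hpq : p = q
    · subst hpq
      rcases le_total (m.factorization p) (n.factorization p) with h | h
      · rw [Nat.sub_eq_zero_of_le h, pow_zero]; exact Nat.coprime_one_right _
      · rw [Nat.sub_eq_zero_of_le h, pow_zero]; exact Nat.coprime_one_left _
    · rw [mem_filter] at hp hq
      exact Nat.Coprime.pow _ _ ((Nat.coprime_primes (hprime p hp.1) (hprime q hq.1)).mpr hpq)
  · exact Nat.Coprime.mul_right (hrB _) (hrB _)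
  · rw [hs]; exact hrB _
  · intro p pp hps
    rw [hs] at hps
    obtain ⟨q, hq, hpq⟩ := (Prime.exists_mem_finset_dvd (Nat.prime_iff.mp pp)) hps
    have hqq := mem_filter.mp hq
    have : p = q := (Nat.prime_dvd_prime_iff_eq pp (hprime q hqq.1)).mp (pp.dvd_of_dvd_pow hpq)
    subst this
    rw [← prod_mul_distrib]
    refine dvd_trans ?_ (dvd_prod_of_mem _ hq)
    rw [← pow_add]
    exact dvd_pow_self _ (by have := hqq.2; omega)

theorem overlap_integral_bound :
    ∃ C : ℝ, 0 < C ∧ ∀ (ψ : ℕ → ℝ), (∀ j, 0 ≤ ψ j) →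
      ∀ (m n : ℕ), 0 < m → 0 < n → m ≠ n →
      0 < ψ m → ψ m ≤ 1 / 2 → 0 < ψ n → ψ n ≤ 1 / 2 →
      ∀ (r s t : ℕ),
      r = ∏ p ∈ (m * n).primeFactors.filter
          (fun p => m.factorization p = n.factorization p), p ^ m.factorization p →
      s = ∏ p ∈ (m * n).primeFactors.filter
          (fun p => m.factorization p ≠ n.factorization p),
          p ^ min (m.factorization p) (n.factorization p) →
      t = ∏ p ∈ (m * n).primeFactors.filter
          (fun p => m.factorization p ≠ n.factorization p),
          p ^ max (m.factorization p) (n.factorization p) →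
      (volume (E ψ m ∩ E ψ n)).toReal ≤
        C * min (ψ m / m) (ψ n / n) * (Nat.totient s : ℝ) *
          ((Nat.totient r : ℝ) ^ 2 / r) *
          ∫ θ in (1 : ℝ)..(max 1 (4 * max (ψ m / m) (ψ n / n) * r * t)), S t θ := by
  refine ⟨16, by norm_num, ?_⟩
  intro ψ _ m n hm hn hmn hψm _ hψn _ r s t hr hs ht
  obtain ⟨M, N, hm', hn', ht', c1, c2, c3, c4⟩ := structure_mn m n r s t hm hn hr hs ht
  have hpos : r * N * s ≠ 0 := by rw [← hm']; exact hm.ne'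
  have hpos' : r * M * s ≠ 0 := by rw [← hn']; exact hn.ne'
  have hM : 0 < M := Nat.pos_of_ne_zero (by rintro rfl; simp at hpos')
  have hN : 0 < N := Nat.pos_of_ne_zero (by rintro rfl; simp at hpos)
  have hr0 : 0 < r := Nat.pos_of_ne_zero (by rintro rfl; simp at hpos)
  have hs0 : 0 < s := Nat.pos_of_ne_zero (by rintro rfl; simp at hpos)
  have ht1 : M * N * s ≠ 1 := by
    intro h
    have h1 := Nat.eq_one_of_mul_eq_one_right h
    have hM1 := Nat.eq_one_of_mul_eq_one_right h1
    have hN1 := Nat.eq_one_of_mul_eq_one_left h1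
    exact hmn (by rw [hm', hn', hM1, hN1])
  have h1 := E_vol ψ m n hψm hψn
  have h2 := QQ_card r s M N (2 * max (ψ m / m) (ψ n / n)) c1 c2 c3 c4 hM hN hr0 hs0 ht1
  rw [← hm', ← hn', ← ht'] at h2
  refine h1.trans ((mul_le_mul_of_nonneg_right h2 (by positivity)).trans_eq ?_)
  have : 2 * (2 * max (ψ m / m) (ψ n / n) * r * t) = 4 * max (ψ m / m) (ψ n / n) * r * t := by ring
  rw [this]
  ring
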